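/- Let n ≥ 1, ρ > 0, N ∈ ℕ, L = 2n − 2, and let Ω ⊂ ℝⁿ be a bounded set. Let q ∈ C^∞(ℝ × ℝⁿ) be supported in ℝ × B̄(0,ρ) with all derivatives bounded, and let a_0, a_1, …, a_N be defined by the recursion a_0(t,x,ω) = −(1/2) ∫_{−∞}^0 q(t+τ, x+τω) dτ, a_j(t,x,ω) = −(1/2) ∫_{−∞}^0 [(∂_t² − Δ_x + q) a_{j−1}](t+τ, x+τω, ω) dτ. If ‖q‖_{C^{L+2N}(ℝ × ℝⁿ)} ≤ 1, then there is a constant C_{Ω,N} > 0, depending only on Ω, N, n, ρ, such that Σ_{j=0}^{N} sup_{t ∈ ℝ, ω ∈ S^{n−1}} ‖a_j(t, ·, ω)‖_{C^{L}(Ω̄)} ≤ C_{Ω,N} · ‖q‖_{C^{L+2N}(ℝ × ℝⁿ)}. -/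

import Mathlib

open MeasureTheory Finset

noncomputable section

abbrev Euc (n : ℕ) := EuclideanSpace ℝ (Fin n)

variable {n : ℕ}

/-- Partial derivative in the `i`-th coordinate direction. -/
def pd {F : Type*} [NormedAddCommGroup F] [NormedSpace ℝ F]
    (i : Fin n) (g : Euc n → F) : Euc n → F :=
  fun x => fderiv ℝ g x (EuclideanSpace.single i 1)

/-- Multi-index partial derivative `D^γ`. -/
def mderiv {F : Type*} [NormedAddCommGroup F] [NormedSpace ℝ F]
    (γ : Fin n → ℕ) (g : Euc n → F) : Euc n → F :=
  ((List.ofFn (fun i : Fin n => (fun h : Euc n → F => (pd i)^[γ i] h))).foldr (· ∘ ·) id) g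

/-- The (finite) set of multi-indices `γ` with `|γ| ≤ m`. -/
def midx (n m : ℕ) : Finset (Fin n → Fin (m + 1)) :=
  Finset.univ.filter (fun γ => ∑ i, (γ i : ℕ) ≤ m)

/-- The `C^m(K)` norm: `∑_{|γ| ≤ m} sup_{x ∈ K} |D^γ g(x)|`. -/
def CnormOn {F : Type*} [NormedAddCommGroup F] [NormedSpace ℝ F]
    (m : ℕ) (K : Set (Euc n)) (g : Euc n → F) : ℝ :=
  ∑ γ ∈ midx n m, ⨆ x ∈ K, ‖mderiv (fun i => (γ i : ℕ)) g x‖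

/-- Parametrization of the hyperplane `ω^⊥` by Euclidean space of the matching dimension,
via an orthonormal basis; this identification is measure preserving. -/
def perpEmb (ω : Euc n) :
    EuclideanSpace ℝ (Fin (Module.finrank ℝ ((Submodule.span ℝ {ω})ᗮ : Submodule ℝ (Euc n)))) →
      Euc n :=
  fun y => ((stdOrthonormalBasis ℝ ((Submodule.span ℝ {ω})ᗮ : Submodule ℝ (Euc n))).repr.symm y :
    Euc n)

/-- The weighted Radon transform `R_μ f(p,ω) = ∫_{ω^⊥} μ(pω + y, ω) f(pω + y) dy`,
the integral over the hyperplane `{x : x·ω = p}` with respect to the `(n-1)`-dimensional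
Lebesgue measure on `ω^⊥`. -/
def Rw (μ : Euc n → Euc n → ℂ) (f : Euc n → ℂ) (p : ℝ) (ω : Euc n) : ℂ :=
  ∫ y, μ (p • ω + perpEmb ω y) ω * f (p • ω + perpEmb ω y)

/-- The `L²(S^{n-1}; H^L(ℝ))` norm of a function `G(p, ω)`. -/
def L2H (L : ℕ) (G : ℝ → Metric.sphere (0 : Euc n) 1 → ℂ) : ℝ :=
  Real.sqrt (∫ ω, (∑ l ∈ Finset.range (L + 1),
    ∫ p : ℝ, ‖iteratedDeriv l (fun p' => G p' ω) p‖ ^ 2)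
      ∂((volume : Measure (Euc n)).toSphere))

/-- The wave operator with potential, `(∂_t² - Δ_x + q)a`, acting on `a(t,x,ω)` in `(t,x)`. -/
def waveOp (q : ℝ → Euc n → ℝ) (a : ℝ → Euc n → Euc n → ℝ) : ℝ → Euc n → Euc n → ℝ :=
  fun t x ω => iteratedDeriv 2 (fun s => a s x ω) t
    - (∑ i, pd i (pd i (fun y => a t y ω)) x) + q t x * a t x ω

/-- The amplitudes `a_j` of the progressive wave expansion:
`a_0(t,x,ω) = -(1/2)∫_{-∞}^0 q(t+τ, x+τω) dτ` and
`a_j(t,x,ω) = -(1/2) ∫_{-∞}^0 [(∂_t² - Δ + q) a_{j-1}](t+τ, x+τω, ω) dτ`. -/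
def aSeq (q : ℝ → Euc n → ℝ) : ℕ → ℝ → Euc n → Euc n → ℝ
  | 0 => fun t x ω => (-(1 : ℝ) / 2) * ∫ τ in Set.Iic (0 : ℝ), q (t + τ) (x + τ • ω)
  | (j + 1) => fun t x ω => (-(1 : ℝ) / 2) *
      ∫ τ in Set.Iic (0 : ℝ), waveOp q (aSeq q j) (t + τ) (x + τ • ω) ω

/-- Time derivative operator on functions of `(t,x)`. -/
def tD (g : ℝ → Euc n → ℝ) : ℝ → Euc n → ℝ := fun t x => deriv (fun s => g s x) t

/-- Spatial partial derivative operator on functions of `(t,x)`. -/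
def xD (i : Fin n) (g : ℝ → Euc n → ℝ) : ℝ → Euc n → ℝ :=
  fun t x => fderiv ℝ (g t) x (EuclideanSpace.single i 1)

/-- Mixed multi-index derivative `∂_t^{γ₀} D_x^γ` on functions of `(t,x)`. -/
def mderivTX (γ0 : ℕ) (γ : Fin n → ℕ) (g : ℝ → Euc n → ℝ) : ℝ → Euc n → ℝ :=
  ((List.ofFn (fun i : Fin n => fun h : ℝ → Euc n → ℝ => (xD i)^[γ i] h)).foldr (· ∘ ·) id)
    (tD^[γ0] g)

/-- Multi-indices in the variables `(t,x)` of total order at most `m`. -/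
def midxTX (n m : ℕ) : Finset (Fin (m + 1) × (Fin n → Fin (m + 1))) :=
  Finset.univ.filter (fun p => (p.1 : ℕ) + ∑ i, (p.2 i : ℕ) ≤ m)

/-- The `C^m(ℝ × K)` norm in the variables `(t,x)`:
`∑_{|γ₀|+|γ| ≤ m} sup_{t ∈ ℝ, x ∈ K} |∂_t^{γ₀} D_x^γ g(t,x)|`. -/
def CnormTXOn (m : ℕ) (K : Set (Euc n)) (g : ℝ → Euc n → ℝ) : ℝ :=
  ∑ p ∈ midxTX n m, ⨆ t : ℝ, ⨆ x ∈ K, ‖mderivTX (p.1 : ℕ) (fun i => (p.2 i : ℕ)) g t x‖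

/-! ### Helper material -/

/-- Directions in space-time. -/
def dirv (o : Option (Fin n)) : ℝ × Euc n :=
  match o with
  | none => (1, 0)
  | some i => (0, EuclideanSpace.single i 1)

/-- Directional derivative. -/
def dD (v : ℝ × Euc n) (f : ℝ × Euc n → ℝ) : ℝ × Euc n → ℝ := fun p => fderiv ℝ f p v

/-- Iterated directional derivative along a word, innermost first. -/
def DW : List (Option (Fin n)) → (ℝ × Euc n → ℝ) → (ℝ × Euc n → ℝ)
  | [], f => f
  | o :: l, f => DW l (dD (dirv o) f)

abbrev Sm (f : ℝ × Euc n → ℝ) : Prop := ContDiff ℝ (⊤ : ℕ∞) f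

lemma Sm.diff {f : ℝ × Euc n → ℝ} (hf : Sm f) : Differentiable ℝ f :=
  hf.differentiable (by simp)

lemma Sm.dD {f : ℝ × Euc n → ℝ} (hf : Sm f) (v : ℝ × Euc n) : Sm (dD v f) := by
  have := (contDiff_infty_iff_fderiv.1 hf).2
  exact this.clm_apply contDiff_const

lemma Sm.DW {f : ℝ × Euc n → ℝ} (hf : Sm f) (l : List (Option (Fin n))) : Sm (DW l f) := by
  induction l generalizing f with
  | nil => exact hf
  | cons o l ih => exact ih (hf.dD _)

lemma dD_add {f g : ℝ × Euc n → ℝ} (hf : Sm f) (hg : Sm g) (v : ℝ × Euc n) :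
    dD v (fun p => f p + g p) = fun p => dD v f p + dD v g p := by
  funext p
  simp only [dD]
  rw [fderiv_fun_add (hf.diff p) (hg.diff p)]
  rfl

lemma dD_smul {f : ℝ × Euc n → ℝ} (hf : Sm f) (c : ℝ) (v : ℝ × Euc n) :
    dD v (fun p => c * f p) = fun p => c * dD v f p := by
  funext p
  simp only [dD]
  rw [fderiv_const_mul (hf.diff p)]
  rfl

lemma dD_mul {f g : ℝ × Euc n → ℝ} (hf : Sm f) (hg : Sm g) (v : ℝ × Euc n) :
    dD v (fun p => f p * g p) = fun p => dD v f p * g p + f p * dD v g p := by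
  funext p
  simp only [dD]
  rw [fderiv_fun_mul (hf.diff p) (hg.diff p)]
  simp
  ring

lemma dD_comm {f : ℝ × Euc n → ℝ} (hf : Sm f) (v w : ℝ × Euc n) :
    dD v (dD w f) = dD w (dD v f) := by
  funext p
  have hd : DifferentiableAt ℝ (fderiv ℝ f) p :=
    ((contDiff_infty_iff_fderiv.1 hf).2.differentiable (by simp)) p
  have h2 : IsSymmSndFDerivAt ℝ f p := by
    apply ContDiffAt.isSymmSndFDerivAt hf.contDiffAt
    simp only [minSmoothness_of_isRCLikeNormedField]
    exact WithTop.coe_le_coe.2 (le_top : (2 : ℕ∞) ≤ ⊤)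
  have key : ∀ a b : ℝ × Euc n, dD a (dD b f) p = fderiv ℝ (fderiv ℝ f) p a b := by
    intro a b
    unfold dD
    rw [fderiv_clm_apply hd (differentiableAt_const _)]
    simp
  rw [key, key]
  exact h2 v w

lemma DW_append (l l' : List (Option (Fin n))) (f : ℝ × Euc n → ℝ) :
    DW (l ++ l') f = DW l' (DW l f) := by
  induction l generalizing f with
  | nil => rfl
  | cons o l ih => exact ih _

lemma DW_perm {l l' : List (Option (Fin n))} (h : l.Perm l') {f : ℝ × Euc n → ℝ} (hf : Sm f) :
    DW l f = DW l' f := by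
  induction h generalizing f with
  | nil => rfl
  | cons o _ ih => exact ih (hf.dD _)
  | swap a b l => simp only [DW]; rw [dD_comm hf]
  | trans _ _ h1 h2 => exact (h1 hf).trans (h2 hf)

lemma DW_add {f g : ℝ × Euc n → ℝ} (hf : Sm f) (hg : Sm g) (l : List (Option (Fin n))) :
    DW l (fun p => f p + g p) = fun p => DW l f p + DW l g p := by
  induction l generalizing f g with
  | nil => rfl
  | cons o l ih => simp only [DW]; rw [dD_add hf hg]; exact ih (hf.dD _) (hg.dD _)

lemma DW_smul {f : ℝ × Euc n → ℝ} (hf : Sm f) (c : ℝ) (l : List (Option (Fin n))) :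
    DW l (fun p => c * f p) = fun p => c * DW l f p := by
  induction l generalizing f with
  | nil => rfl
  | cons o l ih => simp only [DW]; rw [dD_smul hf]; exact ih (hf.dD _)

lemma DW_zero (l : List (Option (Fin n))) :
    DW l (fun _ => (0 : ℝ)) = fun _ => 0 := by
  have := DW_smul (n := n) (f := fun _ => (0 : ℝ)) contDiff_const 0 l
  simpa using this

lemma DW_sum {ι : Type*} (s : Finset ι) {f : ι → ℝ × Euc n → ℝ} (hf : ∀ i, Sm (f i))
    (l : List (Option (Fin n))) :
    DW l (fun p => ∑ i ∈ s, f i p) = fun p => ∑ i ∈ s, DW l (f i) p := by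
  classical
  induction s using Finset.induction_on with
  | empty => simpa using DW_zero l
  | insert a s ha ih =>
    simp only [Finset.sum_insert ha]
    rw [DW_add (hf a) (ContDiff.sum fun i _ => hf i), ih]

lemma DW_mul_bound {f g : ℝ × Euc n → ℝ} (hf : Sm f) (hg : Sm g) (p : ℝ × Euc n) (m : ℕ)
    (a b : ℝ) (ha : ∀ l : List (Option (Fin n)), l.length ≤ m → |DW l f p| ≤ a)
    (hb : ∀ l : List (Option (Fin n)), l.length ≤ m → |DW l g p| ≤ b)
    (l : List (Option (Fin n))) (hl : l.length ≤ m) :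
    |DW l (fun p => f p * g p) p| ≤ 2 ^ m * (a * b) := by
  have ha0 : 0 ≤ a := (abs_nonneg _).trans (ha [] (by simp))
  have hb0 : 0 ≤ b := (abs_nonneg _).trans (hb [] (by simp))
  induction l generalizing f g m with
  | nil =>
    have h1 := ha [] (by simp)
    have h2 := hb [] (by simp)
    simp only [DW] at *
    rw [abs_mul]
    have h3 : |f p| * |g p| ≤ a * b := by gcongr
    have h4 : (1 : ℝ) ≤ 2 ^ m := one_le_pow₀ (by norm_num)
    have : 0 ≤ a * b := by positivity
    nlinarith
  | cons o l ih =>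
    obtain ⟨m, rfl⟩ : ∃ k, m = k + 1 := ⟨m - 1, by simp at hl; omega⟩
    simp only [List.length_cons, add_le_add_iff_right] at hl
    simp only [DW]
    rw [dD_mul hf hg, DW_add ((hf.dD _).mul hg) (hf.mul (hg.dD _))]
    have h1 := ih (hf.dD (dirv o)) hg m (fun l' hl' => ha (o :: l') (by simpa using hl'))
      (fun l' hl' => hb l' (by omega)) hl
    have h2 := ih hf (hg.dD (dirv o)) m (fun l' hl' => ha l' (by omega))
      (fun l' hl' => hb (o :: l') (by simpa using hl')) hl
    refine (abs_add_le _ _).trans ?_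
    rw [pow_succ]
    linarith

/-- Vanishing in the far past half space. -/
def Van (ρ : ℝ) (ω : Euc n) (f : ℝ × Euc n → ℝ) : Prop :=
  ∀ p : ℝ × Euc n, inner ℝ p.2 ω < -ρ → f p = 0

lemma Van.dD {ρ : ℝ} {ω : Euc n} {f : ℝ × Euc n → ℝ} (h : Van ρ ω f) (v : ℝ × Euc n) :
    Van ρ ω (dD v f) := by
  intro p hp
  have hc : Continuous fun p : ℝ × Euc n => (inner ℝ p.2 ω : ℝ) := by fun_prop
  have : f =ᶠ[nhds p] fun _ => 0 := by
    filter_upwards [(isOpen_Iio.preimage hc).mem_nhds hp] with y hy using h y hy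
  simp [_root_.dD, this.fderiv_eq]

lemma Van.DW {ρ : ℝ} {ω : Euc n} {f : ℝ × Euc n → ℝ} (h : Van ρ ω f)
    (l : List (Option (Fin n))) : Van ρ ω (DW l f) := by
  induction l generalizing f with
  | nil => exact h
  | cons o l ih => exact ih (h.dD _)

/-- Transport integral. -/
def IT (ω : Euc n) (f : ℝ × Euc n → ℝ) : ℝ × Euc n → ℝ := fun p =>
  ∫ τ in Set.Iic (0 : ℝ), f (p + τ • ((1, ω) : ℝ × Euc n))

lemma inner_shift {ω : Euc n} (hω : ‖ω‖ = 1) (p : ℝ × Euc n) (τ : ℝ) :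
    inner ℝ (p + τ • ((1, ω) : ℝ × Euc n)).2 ω = inner ℝ p.2 ω + τ := by
  simp [inner_add_left, inner_smul_left, hω]

lemma IT_eq {ρ : ℝ} {ω : Euc n} (hω : ‖ω‖ = 1) {f : ℝ × Euc n → ℝ} (h : Van ρ ω f)
    {M : ℝ} (hM : 0 ≤ M) (p : ℝ × Euc n) (hp : ‖p.2‖ < M - ρ) :
    IT ω f p = ∫ τ in (-M)..0, f (p + τ • ((1, ω) : ℝ × Euc n)) := by
  rw [intervalIntegral.integral_of_le (by linarith), IT]
  apply setIntegral_eq_of_subset_of_forall_sdiff_eq_zero measurableSet_Iic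
  · intro x hx; exact hx.2
  · intro τ hτ
    apply h
    rw [inner_shift hω]
    have h1 : inner ℝ p.2 ω ≤ ‖p.2‖ := by
      simpa [hω] using real_inner_le_norm p.2 ω
    have h2 : τ ≤ -M := by
      by_contra hc
      exact hτ.2 ⟨not_le.1 hc, hτ.1⟩
    linarith

lemma Van.IT {ρ : ℝ} {ω : Euc n} (hω : ‖ω‖ = 1) {f : ℝ × Euc n → ℝ} (h : Van ρ ω f) :
    Van ρ ω (IT ω f) := by
  intro p hp
  rw [_root_.IT, setIntegral_congr_fun (g := fun _ => (0 : ℝ)) measurableSet_Iic, integral_zero]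
  intro τ hτ
  apply h
  rw [inner_shift hω]
  have : τ ≤ 0 := hτ
  linarith

lemma IT_hasFDerivAt {ρ : ℝ} (hρ : 0 < ρ) {ω : Euc n} (hω : ‖ω‖ = 1) {f : ℝ × Euc n → ℝ}
    (hf : Sm f) (h : Van ρ ω f) (p : ℝ × Euc n) :
    ∃ L : ℝ × Euc n →L[ℝ] ℝ, HasFDerivAt (IT ω f) L p ∧ ∀ v, L v = IT ω (dD v f) p := by
  set u : ℝ × Euc n := (1, ω) with hu
  set M : ℝ := ‖p.2‖ + 1 + ρ with hMdef
  have hM : 0 ≤ M := by positivity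
  have hcd : Continuous (fderiv ℝ f) := (contDiff_infty_iff_fderiv.1 hf).2.continuous
  have hcf : Continuous f := hf.continuous
  obtain ⟨B, hB⟩ : ∃ B, ∀ z ∈ Metric.closedBall p 1 ×ˢ Set.Icc (-M) 0,
      ‖fderiv ℝ f (z.1 + z.2 • u)‖ ≤ B :=
    ((isCompact_closedBall p 1).prod isCompact_Icc).exists_bound_of_continuousOn
      (f := fun z : (ℝ × Euc n) × ℝ => fderiv ℝ f (z.1 + z.2 • u))
      (by fun_prop)
  have key := intervalIntegral.hasFDerivAt_integral_of_dominated_of_fderiv_le (𝕜 := ℝ)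
    (μ := volume) (a := -M) (b := 0) (F := fun x τ => f (x + τ • u))
    (F' := fun x τ => fderiv ℝ f (x + τ • u)) (x₀ := p) (s := Metric.closedBall p 1)
    (bound := fun _ => B) (Metric.closedBall_mem_nhds p one_pos)
    (Filter.Eventually.of_forall fun x => by
      apply Continuous.aestronglyMeasurable; fun_prop)
    (by apply Continuous.intervalIntegrable; fun_prop)
    (by apply Continuous.aestronglyMeasurable; fun_prop)
    (Filter.Eventually.of_forall fun τ hτ x hx => by
      rw [Set.uIoc_of_le (by linarith)] at hτ
      exact hB (x, τ) ⟨hx, hτ.1.le, hτ.2⟩)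
    (by simp)
    (Filter.Eventually.of_forall fun τ hτ x hx => by
      exact HasFDerivAt.comp (f := fun y : ℝ × Euc n => y + τ • u) x
        (hf.diff (x + τ • u)).hasFDerivAt ((hasFDerivAt_id x).add_const (τ • u)))
  refine ⟨_, key.congr_of_eventuallyEq ?_, ?_⟩
  · have hc : Continuous fun p : ℝ × Euc n => ‖p.2‖ := by fun_prop
    have hlt : ‖p.2‖ < M - ρ := by rw [hMdef]; linarith
    filter_upwards [(isOpen_Iio.preimage hc).mem_nhds hlt] with y hy
    exact IT_eq hω h hM y hy
  · intro v
    rw [IT_eq hω (h.dD v) hM p (by rw [hMdef]; linarith)]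
    rw [ContinuousLinearMap.intervalIntegral_apply]
    · rfl
    · apply Continuous.intervalIntegrable; fun_prop

lemma dD_IT {ρ : ℝ} (hρ : 0 < ρ) {ω : Euc n} (hω : ‖ω‖ = 1) {f : ℝ × Euc n → ℝ}
    (hf : Sm f) (h : Van ρ ω f) (v : ℝ × Euc n) : dD v (IT ω f) = IT ω (dD v f) := by
  funext p
  obtain ⟨L, hL, hv⟩ := IT_hasFDerivAt hρ hω hf h p
  rw [dD, hL.fderiv, hv]

lemma Sm.IT {ρ : ℝ} (hρ : 0 < ρ) {ω : Euc n} (hω : ‖ω‖ = 1) {f : ℝ × Euc n → ℝ}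
    (hf : Sm f) (h : Van ρ ω f) : Sm (IT ω f) := by
  refine contDiff_infty.2 fun k => ?_
  have hdiff : ∀ g : ℝ × Euc n → ℝ, Sm g → Van ρ ω g → Differentiable ℝ (_root_.IT ω g) := by
    intro g hg hv p
    obtain ⟨L, hL, -⟩ := IT_hasFDerivAt hρ hω hg hv p
    exact hL.differentiableAt
  induction k generalizing f with
  | zero => exact contDiff_zero.2 (hdiff f hf h).continuous
  | succ k ih =>
    push_cast
    rw [contDiff_succ_iff_fderiv_apply]
    refine ⟨hdiff f hf h, by simp, fun v => ?_⟩
    have := ih (hf.dD v) (h.dD v)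
    rw [← dD_IT hρ hω hf h] at this
    exact this

lemma DW_IT {ρ : ℝ} (hρ : 0 < ρ) {ω : Euc n} (hω : ‖ω‖ = 1) {f : ℝ × Euc n → ℝ}
    (hf : Sm f) (h : Van ρ ω f) (l : List (Option (Fin n))) :
    DW l (IT ω f) = IT ω (DW l f) := by
  induction l generalizing f with
  | nil => rfl
  | cons o l ih => simp only [DW]; rw [dD_IT hρ hω hf h]; exact ih (hf.dD _) (h.dD _)

lemma IT_bound {ρ : ℝ} (hρ : 0 < ρ) {ω : Euc n} (hω : ‖ω‖ = 1) {f : ℝ × Euc n → ℝ}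
    (h : Van ρ ω f) {R B : ℝ} (hR : 0 ≤ R)
    (hB : ∀ p : ℝ × Euc n, ‖p.2‖ ≤ 2 * R + ρ + 1 → |f p| ≤ B) (p : ℝ × Euc n)
    (hp : ‖p.2‖ ≤ R) : |IT ω f p| ≤ B * (R + ρ + 1) := by
  rw [IT_eq hω h (M := R + ρ + 1) (by positivity) p (by linarith)]
  have := intervalIntegral.norm_integral_le_of_norm_le_const (a := -(R + ρ + 1)) (b := 0)
    (f := fun τ : ℝ => f (p + τ • ((1, ω) : ℝ × Euc n))) (C := B) (by
      intro τ hτ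
      rw [Set.uIoc_of_le (by linarith)] at hτ
      apply hB
      have h1 : ‖(p + τ • ((1, ω) : ℝ × Euc n)).2‖ ≤ ‖p.2‖ + |τ| := by
        simpa [norm_smul, hω] using norm_add_le p.2 (τ • ω)
      have h2 : |τ| ≤ R + ρ + 1 := by rw [abs_le]; constructor <;> linarith [hτ.1, hτ.2]
      linarith)
  rw [Real.norm_eq_abs] at this
  rwa [zero_sub, neg_neg, abs_of_nonneg (by positivity : 0 ≤ R + ρ + 1)] at this

/-- Uncurrying. -/
def UC (g : ℝ → Euc n → ℝ) : ℝ × Euc n → ℝ := fun p => g p.1 p.2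

lemma UC_tD {g : ℝ → Euc n → ℝ} (hg : Sm (UC g)) : UC (tD g) = dD (dirv none) (UC g) := by
  funext p
  have h1 := (hg.diff (p.1, p.2)).hasFDerivAt.comp_hasDerivAt p.1
    ((hasDerivAt_id p.1).prodMk (hasDerivAt_const p.1 p.2))
  exact h1.deriv

lemma UC_xD {g : ℝ → Euc n → ℝ} (hg : Sm (UC g)) (i : Fin n) :
    UC (xD i g) = dD (dirv (some i)) (UC g) := by
  funext p
  have h1 := HasFDerivAt.comp (f := fun y : Euc n => (p.1, y)) p.2
    (hg.diff (p.1, p.2)).hasFDerivAt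
    ((hasFDerivAt_const p.1 p.2).prodMk (hasFDerivAt_id p.2))
  have h2 := h1.fderiv
  change fderiv ℝ (g p.1) p.2 _ = _
  change fderiv ℝ (g p.1) p.2 = _ at h2
  rw [h2]
  simp [dD, dirv]

lemma UC_tD_iter (k : ℕ) {g : ℝ → Euc n → ℝ} (hg : Sm (UC g)) :
    UC (tD^[k] g) = DW (List.replicate k none) (UC g) := by
  induction k generalizing g with
  | zero => rfl
  | succ k ih =>
    rw [Function.iterate_succ_apply, ih (by rw [UC_tD hg]; exact hg.dD _), UC_tD hg]
    rfl

lemma UC_xD_iter (i : Fin n) (k : ℕ) {g : ℝ → Euc n → ℝ} (hg : Sm (UC g)) :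
    UC ((xD i)^[k] g) = DW (List.replicate k (some i)) (UC g) := by
  induction k generalizing g with
  | zero => rfl
  | succ k ih =>
    rw [Function.iterate_succ_apply, ih (by rw [UC_xD hg]; exact hg.dD _), UC_xD hg]
    rfl

/-- The word of a multi-index. -/
def wd (γ : Fin n → ℕ) : List (Fin n) → List (Option (Fin n))
  | [] => []
  | i :: is => wd γ is ++ List.replicate (γ i) (some i)

lemma UC_fold (γ : Fin n → ℕ) (is : List (Fin n)) {g : ℝ → Euc n → ℝ} (hg : Sm (UC g)) :
    UC (((is.map (fun i : Fin n => fun h : ℝ → Euc n → ℝ => (xD i)^[γ i] h)).foldr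
      (· ∘ ·) id) g) = DW (wd γ is) (UC g) := by
  induction is with
  | nil => rfl
  | cons i is ih =>
    simp only [List.map_cons, List.foldr_cons, Function.comp_apply, wd, DW_append]
    rw [UC_xD_iter i (γ i) (by rw [ih]; exact hg.DW _), ih]

lemma UC_mderivTX (γ0 : ℕ) (γ : Fin n → ℕ) {g : ℝ → Euc n → ℝ} (hg : Sm (UC g)) :
    UC (mderivTX γ0 γ g) =
      DW (List.replicate γ0 none ++ wd γ (List.finRange n)) (UC g) := by
  have h := UC_tD_iter γ0 hg
  rw [DW_append, ← h, mderivTX, List.ofFn_eq_map]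
  exact UC_fold γ _ (by rw [h]; exact hg.DW _)

lemma mderiv_slice (γ : Fin n → ℕ) (g : ℝ → Euc n → ℝ) (t : ℝ) :
    mderiv γ (g t) = mderivTX 0 γ g t := by
  have hit : ∀ (i : Fin n) (k : ℕ) (h : ℝ → Euc n → ℝ),
      (pd i)^[k] (h t) = ((xD i)^[k] h) t := by
    intro i k
    induction k with
    | zero => intro h; rfl
    | succ k ih => intro h; rw [Function.iterate_succ_apply, Function.iterate_succ_apply, ← ih]; rfl
  rw [mderiv, mderivTX, List.ofFn_eq_map, List.ofFn_eq_map]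
  simp only [Function.iterate_zero, id]
  induction List.finRange n with
  | nil => rfl
  | cons i is ih =>
    simp only [List.map_cons, List.foldr_cons, Function.comp_apply]
    rw [ih, hit]

lemma wd_count_none (γ : Fin n → ℕ) (is : List (Fin n)) : (wd γ is).count none = 0 := by
  induction is with
  | nil => rfl
  | cons i is ih => simp [wd, ih, List.count_replicate]

lemma wd_count_some (γ : Fin n → ℕ) (is : List (Fin n)) (j : Fin n) :
    (wd γ is).count (some j) = is.count j * γ j := by
  induction is with
  | nil => simp [wd]
  | cons i is ih =>
    simp only [wd, List.count_append, ih, List.count_replicate, List.count_cons]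
    by_cases h : i = j
    · subst h; simp; ring
    · simp [h]

lemma wd_length (γ : Fin n → ℕ) : (wd γ (List.finRange n)).length = ∑ i, γ i := by
  have : ∀ is : List (Fin n), (wd γ is).length = (is.map γ).sum := by
    intro is
    induction is with
    | nil => rfl
    | cons i is ih => simp [wd, ih]; ring
  rw [this, Fin.sum_univ_def]

lemma perm_word (l : List (Option (Fin n))) :
    l.Perm (List.replicate (l.count none) none ++
      wd (fun i => l.count (some i)) (List.finRange n)) := by
  rw [List.perm_iff_count]
  intro o
  cases o with
  | none => simp [wd_count_none]
  | some j =>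
    rw [List.count_append, wd_count_some, List.count_eq_one_of_mem (List.nodup_finRange n)
      (List.mem_finRange j)]
    simp [List.count_replicate]

lemma iSup_univ_eq (f : Euc n → ℝ) : (⨆ x ∈ (Set.univ : Set (Euc n)), f x) = ⨆ x, f x := by
  simp

lemma q_bound {m : ℕ} {q : ℝ → Euc n → ℝ} (hq : Sm (UC q))
    (hb : ∀ (γ0 : ℕ) (γ : Fin n → ℕ), ∃ B : ℝ, ∀ (t : ℝ) (x : Euc n),
        ‖mderivTX γ0 γ q t x‖ ≤ B) (l : List (Option (Fin n))) (hl : l.length ≤ m)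
    (p : ℝ × Euc n) : |DW l (UC q) p| ≤ CnormTXOn m Set.univ q := by
  have hperm := perm_word l
  have hlen := hperm.length_eq
  rw [List.length_append, wd_length, List.length_replicate] at hlen
  rw [DW_perm hperm hq, ← UC_mderivTX _ _ hq]
  set γ0 := l.count none
  set γ : Fin n → ℕ := fun i => l.count (some i) with hγ
  have hi : ∀ i, γ i ≤ l.length := fun i => List.count_le_length
  have h0 : γ0 ≤ l.length := List.count_le_length
  let P : Fin (m + 1) × (Fin n → Fin (m + 1)) :=
    (⟨γ0, by omega⟩, fun i => ⟨γ i, by have := hi i; omega⟩)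
  have hP : P ∈ midxTX n m := by
    simp only [midxTX, Finset.mem_filter, Finset.mem_univ, true_and, P]
    exact hlen.symm.le.trans hl
  have hnn : ∀ p ∈ midxTX n m, 0 ≤ ⨆ t : ℝ, ⨆ x ∈ (Set.univ : Set (Euc n)),
      ‖mderivTX (p.1 : ℕ) (fun i => (p.2 i : ℕ)) q t x‖ := fun p _ =>
    Real.iSup_nonneg fun t => Real.iSup_nonneg fun x => Real.iSup_nonneg fun _ => norm_nonneg _
  refine le_trans ?_ (Finset.single_le_sum hnn hP)
  obtain ⟨B, hB⟩ := hb γ0 γ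
  have hB0 : 0 ≤ B := (norm_nonneg _).trans (hB 0 0)
  simp only [iSup_univ_eq, P]
  have h1 : ‖mderivTX γ0 γ q p.1 p.2‖ ≤ ⨆ x, ‖mderivTX γ0 γ q p.1 x‖ :=
    le_ciSup (f := fun x => ‖mderivTX γ0 γ q p.1 x‖) ⟨B, by rintro _ ⟨x, rfl⟩; exact hB _ _⟩ p.2
  refine h1.trans ?_
  exact le_ciSup (f := fun t => ⨆ x, ‖mderivTX γ0 γ q t x‖)
    ⟨B, by rintro _ ⟨t, rfl⟩; exact Real.iSup_le (fun x => hB _ _) hB0⟩ p.1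

/-- The wave operator in words. -/
def WO (q f : ℝ × Euc n → ℝ) : ℝ × Euc n → ℝ := fun p =>
  (DW [none, none] f p + (-1) * ∑ i : Fin n, DW [some i, some i] f p) + q p * f p

lemma waveOp_eq (q : ℝ → Euc n → ℝ) (a : ℝ → Euc n → Euc n → ℝ) (ω : Euc n)
    (ha : Sm (UC fun t x => a t x ω)) :
    UC (fun t x => waveOp q a t x ω) = WO (UC q) (UC fun t x => a t x ω) := by
  funext p
  have h1 : iteratedDeriv 2 (fun s => a s p.2 ω) p.1 =
      DW [none, none] (UC fun t x => a t x ω) p := by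
    rw [iteratedDeriv_succ, iteratedDeriv_one]
    have := congrFun (UC_tD_iter 2 ha) p
    exact this
  have h2 : ∀ i, pd i (pd i (fun y => a p.1 y ω)) p.2 =
      DW [some i, some i] (UC fun t x => a t x ω) p := by
    intro i
    exact congrFun (UC_xD_iter i 2 ha) p
  change iteratedDeriv 2 (fun s => a s p.2 ω) p.1
    - (∑ i, pd i (pd i (fun y => a p.1 y ω)) p.2) + q p.1 p.2 * a p.1 p.2 ω = _
  simp only [h1, h2, WO]
  simp only [UC]
  ring

lemma WO_sm {q f : ℝ × Euc n → ℝ} (hq : Sm q) (hf : Sm f) : Sm (WO q f) :=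
  ((hf.DW _).add (contDiff_const.mul (ContDiff.sum fun _ _ => hf.DW _))).add (hq.mul hf)

lemma WO_van {ρ : ℝ} {ω : Euc n} {q f : ℝ × Euc n → ℝ} (h : Van ρ ω f) :
    Van ρ ω (WO q f) := by
  intro p hp
  simp [WO, h.DW _ p hp, h p hp]

lemma WO_bound {q f : ℝ × Euc n → ℝ} (hq : Sm q) (hf : Sm f) (p : ℝ × Euc n) (m : ℕ)
    (b : ℝ) (ha : ∀ l : List (Option (Fin n)), l.length ≤ m → |DW l q p| ≤ 1)
    (hb : ∀ l : List (Option (Fin n)), l.length ≤ m + 2 → |DW l f p| ≤ b)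
    (l : List (Option (Fin n))) (hl : l.length ≤ m) :
    |DW l (WO q f) p| ≤ (1 + n + 2 ^ m) * b := by
  have e : DW l (WO q f) p = (DW (none :: none :: l) f p +
      (-1) * ∑ i : Fin n, DW (some i :: some i :: l) f p) + DW l (fun p => q p * f p) p := by
    unfold WO
    have hs : Sm fun p => ∑ i : Fin n, DW [some i, some i] f p :=
      ContDiff.sum fun i _ => hf.DW _
    rw [DW_add ((hf.DW _).add (contDiff_const.mul hs)) (hq.mul hf),
      DW_add (hf.DW _) (contDiff_const.mul hs), DW_smul hs,
      DW_sum _ (fun i => hf.DW _)]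
    rfl
  rw [e]
  have h1 := hb (none :: none :: l) (by simpa using hl)
  have h2 : |∑ i : Fin n, DW (some i :: some i :: l) f p| ≤ n * b := by
    refine (Finset.abs_sum_le_sum_abs _ _).trans ?_
    refine (Finset.sum_le_card_nsmul _ _ b fun i _ => hb _ (by simpa using hl)).trans ?_
    simp
  have h3 := DW_mul_bound hq hf p m 1 b ha (fun l hl => hb l (by omega)) l hl
  refine (abs_add_le _ _).trans ?_
  have h4 := abs_add_le (DW (none :: none :: l) f p)
    ((-1) * ∑ i : Fin n, DW (some i :: some i :: l) f p)
  rw [abs_mul, abs_neg, abs_one, one_mul] at h4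
  linarith

lemma aSeq_zero_eq (q : ℝ → Euc n → ℝ) (ω : Euc n) :
    UC (fun t x => aSeq q 0 t x ω) = fun p => (-(1 : ℝ) / 2) * IT ω (UC q) p := by
  funext p
  simp [UC, aSeq, IT]

lemma aSeq_succ_eq (q : ℝ → Euc n → ℝ) (ω : Euc n) (j : ℕ)
    (h : Sm (UC fun t x => aSeq q j t x ω)) :
    UC (fun t x => aSeq q (j + 1) t x ω) =
      fun p => (-(1 : ℝ) / 2) * IT ω (WO (UC q) (UC fun t x => aSeq q j t x ω)) p := by
  rw [← waveOp_eq _ _ _ h]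
  funext p
  simp [UC, aSeq, IT]

lemma Van_smul {ρ : ℝ} {ω : Euc n} {f : ℝ × Euc n → ℝ} (h : Van ρ ω f) (c : ℝ) :
    Van ρ ω (fun p => c * f p) := fun p hp => by simp [h p hp]

lemma q_van {ρ : ℝ} {ω : Euc n} (hω : ‖ω‖ = 1) {q : ℝ → Euc n → ℝ}
    (hs : ∀ (t : ℝ) (x : Euc n), x ∉ Metric.closedBall (0 : Euc n) ρ → q t x = 0) :
    Van ρ ω (UC q) := by
  intro p hp
  apply hs
  intro hx
  rw [mem_closedBall_zero_iff] at hx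
  have h1 := neg_le_of_abs_le (abs_real_inner_le_norm p.2 ω)
  rw [hω] at h1
  linarith

lemma aSeq_sm_van {ρ : ℝ} (hρ : 0 < ρ) {ω : Euc n} (hω : ‖ω‖ = 1) {q : ℝ → Euc n → ℝ}
    (hq : Sm (UC q))
    (hs : ∀ (t : ℝ) (x : Euc n), x ∉ Metric.closedBall (0 : Euc n) ρ → q t x = 0) (j : ℕ) :
    Sm (UC fun t x => aSeq q j t x ω) ∧ Van ρ ω (UC fun t x => aSeq q j t x ω) := by
  induction j with
  | zero =>
    rw [aSeq_zero_eq]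
    have hv := q_van hω hs
    exact ⟨contDiff_const.mul (hq.IT hρ hω hv), Van_smul (hv.IT hω) _⟩
  | succ j ih =>
    rw [aSeq_succ_eq _ _ _ ih.1]
    have hv : Van ρ ω (WO (UC q) (UC fun t x => aSeq q j t x ω)) := WO_van ih.2
    exact ⟨contDiff_const.mul ((WO_sm hq ih.1).IT hρ hω hv), Van_smul (hv.IT hω) _⟩

lemma half_IT_bound {ρ : ℝ} (hρ : 0 < ρ) {ω : Euc n} (hω : ‖ω‖ = 1) {f : ℝ × Euc n → ℝ}
    (hf : Sm f) (h : Van ρ ω f) {R B : ℝ} (hR : 0 ≤ R) (l : List (Option (Fin n)))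
    (hB : ∀ p : ℝ × Euc n, ‖p.2‖ ≤ 2 * R + ρ + 1 → |DW l f p| ≤ B) (p : ℝ × Euc n)
    (hp : ‖p.2‖ ≤ R) :
    |DW l (fun p => (-(1 : ℝ) / 2) * IT ω f p) p| ≤ B * (R + ρ + 1) := by
  rw [DW_smul (hf.IT hρ hω h), DW_IT hρ hω hf h, abs_mul]
  have h1 := IT_bound hρ hω (h.DW l) hR hB p hp
  have h2 : |-(1 : ℝ) / 2| = 1 / 2 := by rw [abs_div, abs_neg]; norm_num
  rw [h2]
  have := abs_nonneg (IT ω (DW l f) p)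
  linarith

lemma aSeq_bound {ρ : ℝ} (hρ : 0 < ρ) (m j : ℕ) : ∀ R : ℝ, 0 ≤ R → ∃ C : ℝ, 0 ≤ C ∧
    ∀ q : ℝ → Euc n → ℝ, Sm (UC q) →
      (∀ (t : ℝ) (x : Euc n), x ∉ Metric.closedBall (0 : Euc n) ρ → q t x = 0) →
      (∀ (γ0 : ℕ) (γ : Fin n → ℕ), ∃ B : ℝ, ∀ (t : ℝ) (x : Euc n),
        ‖mderivTX γ0 γ q t x‖ ≤ B) →
      CnormTXOn m Set.univ q ≤ 1 →
      ∀ ω : Euc n, ‖ω‖ = 1 → ∀ l : List (Option (Fin n)), l.length + 2 * j ≤ m →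
      ∀ p : ℝ × Euc n, ‖p.2‖ ≤ R →
        |DW l (UC fun t x => aSeq q j t x ω) p| ≤ C * CnormTXOn m Set.univ q := by
  induction j with
  | zero =>
    intro R hR
    refine ⟨R + ρ + 1, by positivity, ?_⟩
    intro q hq hs hb h1 ω hω l hl p hp
    rw [aSeq_zero_eq, mul_comm]
    exact half_IT_bound hρ hω hq (q_van hω hs) hR l
      (fun p _ => q_bound hq hb l (by omega) p) p hp
  | succ j ih =>
    intro R hR
    obtain ⟨C, hC, H⟩ := ih (2 * R + ρ + 1) (by positivity)
    refine ⟨(1 + n + 2 ^ m) * C * (R + ρ + 1), by positivity, ?_⟩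
    intro q hq hs hb h1 ω hω l hl p hp
    have hj := aSeq_sm_van hρ hω hq hs j
    rw [aSeq_succ_eq _ _ _ hj.1]
    have hQ : 0 ≤ CnormTXOn m Set.univ q :=
      (abs_nonneg _).trans (q_bound hq hb [] (by simp) (0 : ℝ × Euc n))
    refine (half_IT_bound hρ hω (WO_sm hq hj.1) (WO_van hj.2) hR l
      (B := (1 + n + 2 ^ l.length) * (C * CnormTXOn m Set.univ q)) ?_ p hp).trans ?_
    · intro p hp
      exact WO_bound hq hj.1 p l.length _
        (fun l' hl' => (q_bound hq hb l' (by omega) p).trans h1)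
        (fun l' hl' => H q hq hs hb h1 ω hω l' (by omega) p hp) l le_rfl
    · have h2 : (2 : ℝ) ^ l.length ≤ 2 ^ m := pow_le_pow_right₀ (by norm_num) (by omega)
      have h3 : 0 ≤ C * CnormTXOn m Set.univ q * (R + ρ + 1) := by positivity
      nlinarith [mul_le_mul_of_nonneg_right h2 h3]

/-- first half of Lemma 3.9: if `‖q‖_{C^{L+2N}(ℝ×ℝⁿ)} ≤ 1` with `L = 2n-2`,
then `∑_{j=0}^N sup_{t,ω} ‖a_j(t,·,ω)‖_{C^L(Ω̄)} ≤ C_{Ω,N} ‖q‖_{C^{L+2N}(ℝ×ℝⁿ)}`. -/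
theorem stmt6 (n : ℕ) (hn : 1 ≤ n) (ρ : ℝ) (hρ : 0 < ρ) (N : ℕ)
    (Ω : Set (Euc n)) (hΩbdd : Bornology.IsBounded Ω) :
    ∃ C > (0 : ℝ), ∀ q : ℝ → Euc n → ℝ,
      ContDiff ℝ (⊤ : ℕ∞) (fun p : ℝ × Euc n => q p.1 p.2) →
      (∀ (t : ℝ) (x : Euc n), x ∉ Metric.closedBall (0 : Euc n) ρ → q t x = 0) →
      (∀ (γ0 : ℕ) (γ : Fin n → ℕ), ∃ B : ℝ, ∀ (t : ℝ) (x : Euc n),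
        ‖mderivTX γ0 γ q t x‖ ≤ B) →
      CnormTXOn (2 * n - 2 + 2 * N) Set.univ q ≤ 1 →
      (∑ j ∈ Finset.range (N + 1), ⨆ t : ℝ, ⨆ ω : Metric.sphere (0 : Euc n) 1,
          CnormOn (2 * n - 2) (closure Ω) (fun x => aSeq q j t x ω.1)) ≤
        C * CnormTXOn (2 * n - 2 + 2 * N) Set.univ q := by
  obtain ⟨R, hR0, hR⟩ : ∃ R : ℝ, 0 ≤ R ∧ ∀ x ∈ closure Ω, ‖x‖ ≤ R := by
    obtain ⟨R, hR⟩ := hΩbdd.closure.exists_norm_le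
    exact ⟨max R 0, le_max_right _ _, fun x hx => (hR x hx).trans (le_max_left _ _)⟩
  choose C hC0 hC using fun j => aSeq_bound (n := n) hρ (2 * n - 2 + 2 * N) j R hR0
  refine ⟨(∑ j ∈ Finset.range (N + 1), (midx n (2 * n - 2)).card * C j) + 1, ?_, ?_⟩
  · have : 0 ≤ ∑ j ∈ Finset.range (N + 1), ((midx n (2 * n - 2)).card : ℝ) * C j :=
      Finset.sum_nonneg fun j _ => mul_nonneg (by positivity) (hC0 j)
    linarith
  intro q hq hs hb h1
  have hq' : Sm (UC q) := hq
  have hQ : 0 ≤ CnormTXOn (2 * n - 2 + 2 * N) Set.univ q :=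
    (abs_nonneg _).trans (q_bound hq' hb [] (by simp) (0 : ℝ × Euc n))
  set Q := CnormTXOn (2 * n - 2 + 2 * N) Set.univ q with hQdef
  rw [add_mul, Finset.sum_mul, one_mul]
  refine le_add_of_le_of_nonneg (Finset.sum_le_sum fun j hj => ?_) hQ
  have hjN : j ≤ N := by simpa [Nat.lt_succ_iff] using hj
  have hCQ : 0 ≤ C j * Q := mul_nonneg (hC0 j) hQ
  have hnn : 0 ≤ ((midx n (2 * n - 2)).card : ℝ) * C j * Q := by
    rw [mul_assoc]; positivity
  refine Real.iSup_le (fun t => Real.iSup_le (fun ω => ?_) hnn) hnn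
  have hω : ‖ω.1‖ = 1 := by simpa using ω.2
  rw [CnormOn, mul_assoc, ← nsmul_eq_mul]
  refine Finset.sum_le_card_nsmul _ _ _ fun γ hγ => ?_
  refine Real.iSup_le (fun x => Real.iSup_le (fun hx => ?_) hCQ) hCQ
  have hsl := mderiv_slice (fun i => (γ i : ℕ)) (fun t x => aSeq q j t x ω.1) t
  have hsm := (aSeq_sm_van hρ hω hq' hs j).1
  have hu := congrFun (UC_mderivTX 0 (fun i => (γ i : ℕ)) hsm) (t, x)
  have hγ' : ∑ i, (γ i : ℕ) ≤ 2 * n - 2 := by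
    simpa [midx] using hγ
  rw [hsl, Real.norm_eq_abs]
  change mderivTX 0 (fun i => (γ i : ℕ)) (fun t x => aSeq q j t x ω.1) t x = _ at hu
  rw [hu]
  refine hC j q hq' hs hb h1 ω.1 hω _ ?_ (t, x) (hR x hx)
  simp only [List.replicate_zero, List.nil_append, wd_length]
  omega

end
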